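/- There exists n_0 such that for all n ≥ n_0 the following holds: if N is a Keith number with exactly n decimal digits, at least n/2 of which are nonzero, and N = K^N_m, then 10^n/90 < 2^{m−n}·n < 12·10^n. -/

import Mathlib

/-- `keithList a m` is the list of the first `m` terms `K^N_1, …, K^N_m` of the Keith
sequence associated with the digit string `a = [a_1, …, a_n]` (most significant first):
`K^N_m = a_m` for `1 ≤ m ≤ n` and `K^N_m = K^N_{m-1} + ⋯ + K^N_{m-n}` for `m > n`. -/
def keithList (a : List ℕ) : ℕ → List ℕ
  | 0 => []
  | m + 1 =>
      let prev := keithList a m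
      prev ++ [if m < a.length then a.getD m 0 else (prev.drop (m - a.length)).sum]

/-- `keithSeq a m = K^N_m` (1-indexed; `keithSeq a 0 = 0` by convention). -/
def keithSeq (a : List ℕ) (m : ℕ) : ℕ := (keithList a m).getD (m - 1) 0

theorem length_keithList (a : List ℕ) (m : ℕ) : (keithList a m).length = m := by
  induction m with
  | zero => rfl
  | succ m ih => simp [keithList, ih]

theorem keithSeq_succ (a : List ℕ) (m : ℕ) :
    keithSeq a (m + 1) =
      if m < a.length then a.getD m 0 else ((keithList a m).drop (m - a.length)).sum := by
  simp [keithSeq, keithList, length_keithList]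

theorem keithList_eq_map_range (a : List ℕ) (m : ℕ) :
    keithList a m = (List.range m).map fun i => keithSeq a (i + 1) := by
  induction m with
  | zero => rfl
  | succ m ih =>
    rw [List.range_succ, List.map_append, ← ih, List.map_singleton, keithSeq_succ]
    rfl

theorem keithSeq_succ_of_lt {a : List ℕ} {i : ℕ} (hi : i < a.length) :
    keithSeq a (i + 1) = a.getD i 0 := by
  rw [keithSeq_succ, if_pos hi]

theorem keithSeq_length_add_succ (a : List ℕ) (i : ℕ) :
    keithSeq a (a.length + i + 1) = ∑ j ∈ Finset.range a.length, keithSeq a (i + j + 1) := by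
  rw [keithSeq_succ, if_neg (by omega), keithList_eq_map_range, Nat.add_sub_cancel_left,
    Nat.add_comm a.length i, ← List.map_drop, List.range_add, List.drop_left' (by simp),
    List.map_map]
  rfl

theorem keithSeq_add_keithSeq (a : List ℕ) (i : ℕ) :
    keithSeq a (a.length + i + 2) + keithSeq a (i + 1) = 2 * keithSeq a (a.length + i + 1) := by
  have h1 := keithSeq_length_add_succ a (i + 1)
  have h2 := keithSeq_length_add_succ a i
  have h3 := Finset.sum_range_succ (fun j => keithSeq a (i + j + 1)) a.length
  have h4 := Finset.sum_range_succ' (fun j => keithSeq a (i + j + 1)) a.length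
  have h5 : ∀ j, i + (j + 1) + 1 = i + 1 + j + 1 := by intro j; ring
  simp only [h5, add_zero] at h4
  rw [show a.length + i + 2 = a.length + (i + 1) + 1 by ring, h1]
  rw [show i + a.length = a.length + i by ring] at h3
  omega

theorem keithSeq_length_succ (a : List ℕ) : keithSeq a (a.length + 1) = a.sum := by
  have h := keithSeq_length_add_succ a 0
  rw [add_zero] at h
  rw [h, Finset.sum_range, ← Fin.sum_univ_getElem]
  refine Finset.sum_congr rfl fun j _ => ?_
  rw [zero_add, keithSeq_succ_of_lt j.2, List.getD_eq_getElem _ _ j.2]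

theorem keithSeq_length_add_le (a : List ℕ) (j : ℕ) :
    keithSeq a (a.length + j + 1) ≤ 2 ^ j * a.sum := by
  induction j with
  | zero => simp [keithSeq_length_succ]
  | succ j ih =>
    have h := keithSeq_add_keithSeq a j
    calc keithSeq a (a.length + j + 2) ≤ 2 * (2 ^ j * a.sum) := by omega
      _ = 2 ^ (j + 1) * a.sum := by ring

theorem keithSeq_length_add_mono {a : List ℕ} (ha : a ≠ []) :
    Monotone fun j => keithSeq a (a.length + j + 1) := by
  refine monotone_nat_of_le_succ fun j => ?_
  have hle : keithSeq a (j + 1) ≤ keithSeq a (a.length + j + 1) := by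
    rw [keithSeq_length_add_succ]
    exact Finset.single_le_sum (f := fun i => keithSeq a (j + i + 1)) (fun _ _ => Nat.zero_le _)
      (Finset.mem_range.2 (List.length_pos_iff.2 ha))
  have h := keithSeq_add_keithSeq a j
  rw [show a.length + (j + 1) + 1 = a.length + j + 2 by ring]
  omega

theorem getD_le_nine {a : List ℕ} (h9 : ∀ d ∈ a, d ≤ 9) (i : ℕ) : a.getD i 0 ≤ 9 := by
  by_cases hi : i < a.length
  · rw [List.getD_eq_getElem _ _ hi]
    exact h9 _ (List.getElem_mem hi)
  · rw [List.getD_eq_default _ _ (not_lt.1 hi)]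
    norm_num

theorem two_pow_mul_sum_le {a : List ℕ} (h9 : ∀ d ∈ a, d ≤ 9) (j : ℕ) :
    (2 : ℝ) ^ j * a.sum ≤ keithSeq a (a.length + j + 1) + 9 * (2 ^ j - 1) +
      j * 2 ^ j * (9 * a.length / 2 ^ a.length) / 2 := by
  have hsum : (a.sum : ℝ) ≤ 9 * a.length := by
    have := List.sum_le_card_nsmul a 9 h9
    rw [smul_eq_mul, mul_comm] at this
    exact_mod_cast this
  induction j with
  | zero => simp [keithSeq_length_succ]
  | succ j ih =>
    have hrec : (keithSeq a (a.length + (j + 1) + 1) : ℝ) + keithSeq a (j + 1) =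
        2 * keithSeq a (a.length + j + 1) := by
      exact_mod_cast keithSeq_add_keithSeq a j
    have hsmall : (keithSeq a (j + 1) : ℝ) ≤ 9 + 2 ^ j * (9 * a.length / 2 ^ a.length) := by
      rcases lt_or_ge j a.length with hj | hj
      · have : (keithSeq a (j + 1) : ℝ) ≤ 9 := by
          rw [keithSeq_succ_of_lt hj]
          exact_mod_cast getD_le_nine h9 j
        have : (0 : ℝ) ≤ 2 ^ j * (9 * a.length / 2 ^ a.length) := by positivity
        linarith
      · obtain ⟨i, rfl⟩ := Nat.exists_eq_add_of_le hj
        have h1 : (keithSeq a (a.length + i + 1) : ℝ) ≤ 2 ^ i * a.sum := by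
          exact_mod_cast keithSeq_length_add_le a i
        have h2 : (2 : ℝ) ^ i * a.sum ≤ 2 ^ i * (9 * a.length) := by gcongr
        have h3 : (2 : ℝ) ^ (a.length + i) * (9 * a.length / 2 ^ a.length) =
            2 ^ i * (9 * a.length) := by
          rw [pow_add]; field_simp
        linarith
    rw [pow_succ]
    push_cast at *
    linarith

theorem length_filter_ne_zero_le_sum (l : List ℕ) : (l.filter (· ≠ 0)).length ≤ l.sum := by
  induction l with
  | nil => simp
  | cons d l ih =>
    rw [List.filter_cons, List.sum_cons]
    split_ifs with h
    · have : d ≠ 0 := by simpa using h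
      rw [List.length_cons]
      omega
    · omega

theorem eventually_sq_le_two_pow : ∀ᶠ n : ℕ in Filter.atTop, 45 * (n : ℝ) ^ 2 ≤ 2 * 2 ^ n := by
  have h := tendsto_pow_const_div_const_pow_of_one_lt 2 (one_lt_two (α := ℝ))
  filter_upwards [h.eventually (gt_mem_nhds (show (0 : ℝ) < 2 / 45 by norm_num))] with n hn
  rw [div_lt_iff₀ (by positivity)] at hn
  linarith

theorem two_pow_mul_length_le {a : List ℕ} (h9 : ∀ d ∈ a, d ≤ 9) (hsum : a.length ≤ 2 * a.sum)
    (hlen : 40 ≤ a.length) (hsq : 45 * (a.length : ℝ) ^ 2 ≤ 2 * 2 ^ a.length)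
    {j : ℕ} (hj : j ≤ 5 * a.length) :
    (2 : ℝ) ^ j * (a.length / 4) ≤ keithSeq a (a.length + j + 1) := by
  have h := two_pow_mul_sum_le h9 j
  have hj' : (j : ℝ) ≤ 5 * a.length := by exact_mod_cast hj
  have herr : (j : ℝ) * (9 * a.length / 2 ^ a.length) ≤ 2 := by
    rw [← mul_div_assoc, div_le_iff₀ (by positivity)]
    calc (j : ℝ) * (9 * a.length) ≤ 5 * a.length * (9 * a.length) := by gcongr
      _ ≤ 2 * 2 ^ a.length := by linarith
  have hsum' : (a.length : ℝ) ≤ 2 * a.sum := by exact_mod_cast hsum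
  have hlen' : (40 : ℝ) ≤ a.length := by exact_mod_cast hlen
  have hpos : (0 : ℝ) < 2 ^ j := by positivity
  have h1 := mul_le_mul_of_nonneg_left herr hpos.le
  have h2 : (2 : ℝ) ^ j * (a.length / 4) ≤ 2 ^ j * (a.sum - 10) := by
    gcongr
    linarith
  linarith

/-- For all large n: if N is a Keith number with exactly n decimal digits, at least
half of them nonzero, and N = K^N_m, then 10^n/90 < 2^{m−n}·n < 12·10^n. -/
theorem keith_index_asymptotics :
    ∃ n₀ : ℕ, ∀ n, n₀ ≤ n → ∀ N m : ℕ,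
      (Nat.digits 10 N).length = n →
      n ≤ 2 * ((Nat.digits 10 N).filter (· ≠ 0)).length →
      1 ≤ m → keithSeq ((Nat.digits 10 N).reverse) m = N →
      (10 : ℝ) ^ n / 90 < (2 : ℝ) ^ ((m : ℤ) - (n : ℤ)) * (n : ℝ) ∧
      (2 : ℝ) ^ ((m : ℤ) - (n : ℤ)) * (n : ℝ) < 12 * (10 : ℝ) ^ n := by
  obtain ⟨n₁, hn₁⟩ := Filter.eventually_atTop.1 eventually_sq_le_two_pow
  refine ⟨max n₁ 40, fun n hn N m hlen hnz hm hK => ?_⟩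
  have hsq := hn₁ n (le_of_max_le_left hn)
  have hn40 : 40 ≤ n := le_of_max_le_right hn
  have hNlt : N < 10 ^ n := hlen ▸ Nat.lt_base_pow_length_digits (by norm_num)
  have hNge : 10 ^ n ≤ 10 * N := by
    rw [← hlen]
    refine Nat.base_pow_length_digits_le' 8 N ?_
    rintro rfl
    simp at hlen
    omega
  have hfilter := length_filter_ne_zero_le_sum (Nat.digits 10 N)
  have hdigits : ∀ d ∈ (Nat.digits 10 N).reverse, d ≤ 9 := fun d hd =>
    Nat.le_of_lt_succ (Nat.digits_lt_base (by norm_num) (List.mem_reverse.1 hd))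
  have halen : (Nat.digits 10 N).reverse.length = n := by rw [List.length_reverse, hlen]
  have hasum : n ≤ 2 * (Nat.digits 10 N).reverse.sum := by
    rw [List.sum_reverse]
    omega
  generalize (Nat.digits 10 N).reverse = a at *
  subst halen
  have hm' : a.length < m := by
    by_contra! hle
    obtain ⟨i, rfl⟩ := Nat.exists_eq_add_of_le' hm
    have h9 := getD_le_nine hdigits i
    rw [← keithSeq_succ_of_lt (by omega), hK] at h9
    have : 10 ^ 40 ≤ 10 ^ a.length := Nat.pow_le_pow_right (by norm_num) hn40
    omega
  obtain ⟨j, rfl⟩ := Nat.exists_eq_add_of_lt hm'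
  have hexp : (2 : ℝ) ^ (((a.length + j + 1 : ℕ) : ℤ) - (a.length : ℤ)) = 2 * 2 ^ j := by
    rw [show ((a.length + j + 1 : ℕ) : ℤ) - (a.length : ℤ) = ((j + 1 : ℕ) : ℤ) by push_cast; ring,
      zpow_natCast, pow_succ, mul_comm]
  rw [hexp]
  have hNge' : (10 : ℝ) ^ a.length ≤ 10 * N := by exact_mod_cast hNge
  have hNlt' : (N : ℝ) < 10 ^ a.length := by exact_mod_cast hNlt
  have hpos : (0 : ℝ) < 10 ^ a.length := by positivity
  constructor
  · have h1 : (N : ℝ) ≤ 2 ^ j * a.sum := by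
      rw [← hK]
      exact_mod_cast keithSeq_length_add_le a j
    have h2 : (a.sum : ℝ) ≤ 9 * a.length := by
      have := List.sum_le_card_nsmul a 9 hdigits
      rw [smul_eq_mul, mul_comm] at this
      exact_mod_cast this
    have h3 : (2 : ℝ) ^ j * a.sum ≤ 2 ^ j * (9 * a.length) := by gcongr
    linarith
  · rcases le_total j (5 * a.length) with hj | hj
    · have h := two_pow_mul_length_le hdigits hasum hn40 hsq hj
      rw [hK] at h
      linarith
    · exfalso
      have h := two_pow_mul_length_le hdigits hasum hn40 hsq le_rfl
      have hmono := keithSeq_length_add_mono (a := a) (by rintro rfl; simp at hn40) hj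
      simp only [hK] at hmono
      have hmono' : (keithSeq a (a.length + 5 * a.length + 1) : ℝ) ≤ N := by exact_mod_cast hmono
      have h32 : (10 : ℝ) ^ a.length ≤ 2 ^ (5 * a.length) := by
        rw [pow_mul]
        gcongr
        norm_num
      have h4 : (1 : ℝ) ≤ a.length / 4 := by
        have : (40 : ℝ) ≤ a.length := by exact_mod_cast hn40
        linarith
      have h5 : (2 : ℝ) ^ (5 * a.length) ≤ 2 ^ (5 * a.length) * (a.length / 4) :=
        le_mul_of_one_le_right (by positivity) h4
      linarith
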